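/- arXiv:1805.11892 — 2 statements merged into one kernel-verified Lean document; each statement's English description precedes it below -/
import Mathlib

section
/- Lemma 1 (converse, regime P ≥ (K−M)/2). Under the PIR-with-private-side-information setup, with S = {1,…,M}, demand set 𝒫 = {M+1,…,M+P}, and A_1 = A_1^{S,𝒫}, the following entropy inequality holds: (K−M)·L ≤ ∑_{n=1}^{N} H(A_n^{S,𝒫} | Q, W_S) + (K−M−P)·L − H(A_1 | Q, W_S, W_𝒫). -/
open scoped BigOperators

/-- Probability that random variable `X` takes the value `x`, under the
probability mass function `p` on the finite sample space `Ω`. -/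
noncomputable def pr {Ω : Type} [Fintype Ω] (p : Ω → ℝ) {α : Type} [DecidableEq α]
    (X : Ω → α) (x : α) : ℝ :=
  ∑ ω ∈ Finset.univ.filter (fun ω => X ω = x), p ω

/-- Shannon entropy of `X` in base `b` (with the convention `0 * log 0 = 0`). -/
noncomputable def ent {Ω : Type} [Fintype Ω] (b : ℝ) (p : Ω → ℝ) {α : Type} [Fintype α]
    [DecidableEq α] (X : Ω → α) : ℝ :=
  -∑ x : α, pr p X x * Real.logb b (pr p X x)

/-- Conditional entropy `H(X ∣ Y) = H(X, Y) - H(Y)`, in base `b`. -/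
noncomputable def condEnt {Ω : Type} [Fintype Ω] (b : ℝ) (p : Ω → ℝ) {α β : Type} [Fintype α]
    [DecidableEq α] [Fintype β] [DecidableEq β] (X : Ω → α) (Y : Ω → β) : ℝ :=
  ent b p (fun ω => (X ω, Y ω)) - ent b p Y

/-- `X` is a deterministic function of `Y`. -/
def detFn {Ω α β : Type} (X : Ω → α) (Y : Ω → β) : Prop :=
  ∃ f : β → α, ∀ ω, X ω = f (Y ω)

/-- Admissible demand sets: subsets of `{1,…,K} \ S` of size `P`
(indices are `0`-based, and `S = {1,…,M}` corresponds to indices `< M`). -/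
def demands (K M P : ℕ) : Finset (Finset (Fin K)) :=
  Finset.univ.filter (fun T => T.card = P ∧ ∀ i ∈ T, M ≤ i.val)

section Entropy

variable {Ω : Type} [Fintype Ω] {p : Ω → ℝ} {α β γ : Type}
  [Fintype α] [DecidableEq α] [Fintype β] [DecidableEq β] [Fintype γ] [DecidableEq γ]

lemma pr_nonneg (hp : ∀ ω, 0 ≤ p ω) {δ : Type} [DecidableEq δ] (X : Ω → δ) (x : δ) :
    0 ≤ pr p X x :=
  Finset.sum_nonneg fun ω _ => hp ω

lemma le_pr_apply (hp : ∀ ω, 0 ≤ p ω) {δ : Type} [DecidableEq δ] (X : Ω → δ) (ω : Ω) :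
    p ω ≤ pr p X (X ω) :=
  Finset.single_le_sum (f := p) (fun ω _ => hp ω) (by simp)

lemma pr_apply_le_pr_comp (hp : ∀ ω, 0 ≤ p ω) {δ ε : Type} [DecidableEq δ] [DecidableEq ε]
    (Y : Ω → δ) (f : δ → ε) (y : δ) :
    pr p Y y ≤ pr p (fun ω => f (Y ω)) (f y) := by
  refine Finset.sum_le_sum_of_subset_of_nonneg (fun ω hω => ?_) fun ω _ _ => hp ω
  simp only [Finset.mem_filter, Finset.mem_univ, true_and] at hω ⊢
  rw [hω]

lemma sum_mul_comp (X : Ω → α) (g : α → ℝ) :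
    ∑ ω, p ω * g (X ω) = ∑ x, pr p X x * g x := by
  simp only [pr, Finset.sum_mul]
  rw [← Finset.sum_fiberwise (s := Finset.univ) (g := X)]
  refine Finset.sum_congr rfl fun x _ => Finset.sum_congr rfl fun ω hω => ?_
  rw [(Finset.mem_filter.mp hω).2]

lemma ent_eq_sum (b : ℝ) (X : Ω → α) :
    ent b p X = -∑ ω, p ω * Real.logb b (pr p X (X ω)) := by
  rw [ent, sum_mul_comp X fun x => Real.logb b (pr p X x)]

lemma sum_pr (X : Ω → α) : ∑ x, pr p X x = ∑ ω, p ω := by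
  simpa using (sum_mul_comp (p := p) X fun _ => 1).symm

lemma sum_pr_prodMk {δ : Type} [DecidableEq δ] (X : Ω → α) (Y : Ω → δ) (y : δ) :
    ∑ x, pr p (fun ω => (X ω, Y ω)) (x, y) = pr p Y y := by
  simp only [pr]
  rw [← Finset.sum_fiberwise (s := Finset.univ.filter fun ω => Y ω = y) (g := X)]
  refine Finset.sum_congr rfl fun x _ => Finset.sum_congr ?_ fun _ _ => rfl
  ext ω
  simp [and_comm]

lemma ent_le_of_detFn {b : ℝ} (hb : 1 < b) (hp : ∀ ω, 0 ≤ p ω) {X : Ω → α} {Y : Ω → β}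
    (h : detFn X Y) : ent b p X ≤ ent b p Y := by
  obtain ⟨f, hf⟩ := h
  obtain rfl : X = fun ω => f (Y ω) := funext hf
  rw [ent_eq_sum, ent_eq_sum]
  refine neg_le_neg (Finset.sum_le_sum fun ω _ => ?_)
  rcases (hp ω).eq_or_lt with h0 | h0
  · simp [← h0]
  · exact mul_le_mul_of_nonneg_left (Real.logb_le_logb_of_le hb
      (h0.trans_le (le_pr_apply hp Y ω)) (pr_apply_le_pr_comp hp Y f (Y ω))) (hp ω)

lemma ent_eq_of_detFn {b : ℝ} (hb : 1 < b) (hp : ∀ ω, 0 ≤ p ω) {X : Ω → α} {Y : Ω → β}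
    (h : detFn X Y) (h' : detFn Y X) : ent b p X = ent b p Y :=
  le_antisymm (ent_le_of_detFn hb hp h) (ent_le_of_detFn hb hp h')

lemma sum_pr_mul_div_le (hp : ∀ ω, 0 ≤ p ω) (X : Ω → α) (Z : Ω → β) (Y : Ω → γ) :
    ∑ ω, p ω * (pr p (fun ω => (X ω, Y ω)) (X ω, Y ω) * pr p (fun ω => (Z ω, Y ω)) (Z ω, Y ω) /
      (pr p (fun ω => (X ω, Z ω, Y ω)) (X ω, Z ω, Y ω) * pr p Y (Y ω))) ≤ ∑ ω, p ω := by
  rw [sum_mul_comp (fun ω => (X ω, Z ω, Y ω)) fun t : α × β × γ =>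
    pr p (fun ω => (X ω, Y ω)) (t.1, t.2.2) * pr p (fun ω => (Z ω, Y ω)) (t.2.1, t.2.2) /
      (pr p (fun ω => (X ω, Z ω, Y ω)) (t.1, t.2.1, t.2.2) * pr p Y t.2.2)]
  calc
    _ ≤ ∑ t : α × β × γ, pr p (fun ω => (X ω, Y ω)) (t.1, t.2.2) *
          pr p (fun ω => (Z ω, Y ω)) (t.2.1, t.2.2) / pr p Y t.2.2 := by
      refine Finset.sum_le_sum fun t _ => ?_
      rcases (pr_nonneg hp (fun ω => (X ω, Z ω, Y ω)) t).eq_or_lt with h0 | h0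
      · rw [← h0, zero_mul]
        exact div_nonneg (mul_nonneg (pr_nonneg hp _ _) (pr_nonneg hp _ _)) (pr_nonneg hp _ _)
      · apply le_of_eq
        change _ * (_ / (pr p (fun ω => (X ω, Z ω, Y ω)) t * _)) = _
        rw [div_mul_eq_div_div_swap, mul_div_cancel₀ _ h0.ne']
    _ = ∑ y, pr p Y y * pr p Y y / pr p Y y := by
      simp only [Fintype.sum_prod_type]
      rw [Finset.sum_congr rfl fun x _ => Finset.sum_comm, Finset.sum_comm]
      refine Finset.sum_congr rfl fun y _ => ?_
      simp only [← Finset.sum_div, ← Finset.mul_sum, ← Finset.sum_mul, sum_pr_prodMk]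
    _ = ∑ ω, p ω := by
      simp only [mul_self_div_self, sum_pr]

lemma ent_submodular {b : ℝ} (hb : 1 < b) (hp : ∀ ω, 0 ≤ p ω)
    (X : Ω → α) (Z : Ω → β) (Y : Ω → γ) :
    ent b p (fun ω => (X ω, Z ω, Y ω)) + ent b p Y ≤
      ent b p (fun ω => (X ω, Y ω)) + ent b p (fun ω => (Z ω, Y ω)) := by
  have key : ∀ ω, p ω * Real.log (pr p (fun ω => (X ω, Y ω)) (X ω, Y ω)) +
      p ω * Real.log (pr p (fun ω => (Z ω, Y ω)) (Z ω, Y ω)) -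
      p ω * Real.log (pr p (fun ω => (X ω, Z ω, Y ω)) (X ω, Z ω, Y ω)) -
      p ω * Real.log (pr p Y (Y ω)) ≤
      p ω * (pr p (fun ω => (X ω, Y ω)) (X ω, Y ω) * pr p (fun ω => (Z ω, Y ω)) (Z ω, Y ω) /
      (pr p (fun ω => (X ω, Z ω, Y ω)) (X ω, Z ω, Y ω) * pr p Y (Y ω))) - p ω := by
    intro ω
    rcases (hp ω).eq_or_lt with h0 | h0
    · simp [← h0]
    have h1 := h0.trans_le (le_pr_apply hp (fun ω => (X ω, Y ω)) ω)
    have h2 := h0.trans_le (le_pr_apply hp (fun ω => (Z ω, Y ω)) ω)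
    have h3 := h0.trans_le (le_pr_apply hp (fun ω => (X ω, Z ω, Y ω)) ω)
    have h4 := h0.trans_le (le_pr_apply hp Y ω)
    have h5 := mul_le_mul_of_nonneg_left (Real.log_le_sub_one_of_pos
      (div_pos (mul_pos h1 h2) (mul_pos h3 h4))) h0.le
    rw [Real.log_div (mul_pos h1 h2).ne' (mul_pos h3 h4).ne', Real.log_mul h1.ne' h2.ne',
      Real.log_mul h3.ne' h4.ne'] at h5
    linarith
  have hsum := Finset.sum_le_sum fun ω (_ : ω ∈ Finset.univ) => key ω
  simp only [Finset.sum_sub_distrib, Finset.sum_add_distrib] at hsum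
  have hle := sum_pr_mul_div_le hp X Z Y
  simp only [ent_eq_sum, Real.logb, ← mul_div_assoc, ← Finset.sum_div, ← neg_div, ← add_div]
  exact div_le_div_of_nonneg_right (by linarith) (Real.log_pos hb).le

lemma ent_le_of_decodable {δ ε : Type} [Fintype δ] [DecidableEq δ] [Fintype ε] [DecidableEq ε]
    {b : ℝ} (hb : 1 < b) (hp : ∀ ω, 0 ≤ p ω) {Z : Ω → β} {Y : Ω → γ} {U : Ω → δ} {V : Ω → ε}
    (f : β → α) (h : detFn V fun ω => (Z ω, Y ω, U ω)) :
    ent b p (fun ω => (f (Z ω), Y ω, U ω, V ω)) ≤ ent b p (fun ω => (Z ω, Y ω, U ω)) := by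
  obtain ⟨g, hg⟩ := h
  refine ent_le_of_detFn hb hp ⟨fun t => (f t.1, t.2.1, t.2.2, g t), fun ω => ?_⟩
  simp only [hg ω]

lemma condEnt_le_of_detFn {b : ℝ} (hb : 1 < b) (hp : ∀ ω, 0 ≤ p ω) {X : Ω → α} {Z : Ω → β}
    (h : detFn X Z) (Y : Ω → γ) : condEnt b p X Y ≤ condEnt b p Z Y := by
  obtain ⟨f, hf⟩ := h
  have hle : ent b p (fun ω => (X ω, Y ω)) ≤ ent b p (fun ω => (Z ω, Y ω)) :=
    ent_le_of_detFn hb hp ⟨fun t => (f t.1, t.2), fun ω => Prod.ext (hf ω) rfl⟩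
  simp only [condEnt]
  linarith

lemma condEnt_prodMk_le {b : ℝ} (hb : 1 < b) (hp : ∀ ω, 0 ≤ p ω)
    (X : Ω → α) (Z : Ω → β) (Y : Ω → γ) :
    condEnt b p (fun ω => (X ω, Z ω)) Y ≤ condEnt b p X Y + condEnt b p Z Y := by
  have hsub := ent_submodular hb hp X Z Y
  have hassoc : ent b p (fun ω => ((X ω, Z ω), Y ω)) ≤ ent b p (fun ω => (X ω, Z ω, Y ω)) :=
    ent_le_of_detFn hb hp ⟨fun t => ((t.1, t.2.1), t.2.2), fun _ => rfl⟩
  simp only [condEnt]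
  linarith

lemma condEnt_of_unique [Unique α] {b : ℝ} (hb : 1 < b) (hp : ∀ ω, 0 ≤ p ω)
    (X : Ω → α) (Y : Ω → γ) : condEnt b p X Y = 0 :=
  sub_eq_zero.mpr (ent_eq_of_detFn hb hp
    ⟨fun y => (default, y), fun _ => Prod.ext (Subsingleton.elim _ _) rfl⟩
    ⟨Prod.snd, fun _ => rfl⟩)

lemma condEnt_pi_fin_le_sum {b : ℝ} (hb : 1 < b) (hp : ∀ ω, 0 ≤ p ω) (Y : Ω → γ) :
    ∀ (n : ℕ) (A : Fin n → Ω → α),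
      condEnt b p (fun ω i => A i ω) Y ≤ ∑ i, condEnt b p (A i) Y
  | 0, A => by
    rw [Finset.univ_eq_empty, Finset.sum_empty]
    exact (condEnt_of_unique hb hp _ Y).le
  | n + 1, A => by
    rw [Fin.sum_univ_succ]
    have hcons : detFn (fun ω i => A i ω) (fun ω => (A 0 ω, fun i : Fin n => A i.succ ω)) :=
      ⟨fun t => Fin.cons t.1 t.2, fun ω => (Fin.cons_self_tail fun i => A i ω).symm⟩
    exact (condEnt_le_of_detFn hb hp hcons Y).trans ((condEnt_prodMk_le hb hp _ _ Y).trans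
      (add_le_add_right (condEnt_pi_fin_le_sum hb hp Y n fun i => A i.succ) _))

end Entropy

section UniformFiles

variable {Ω : Type} [Fintype Ω] {p : Ω → ℝ} {κ V R : Type} [Fintype κ] [DecidableEq κ]
  [Fintype V] [DecidableEq V] [Nonempty V] [DecidableEq R]

lemma pr_restrict_of_uniform {W : κ → Ω → V} {Q : Ω → R}
    (hU : ∀ w q, pr p (fun ω => ((fun i => W i ω), Q ω)) (w, q) =
      ((Fintype.card V : ℝ) ^ Fintype.card κ)⁻¹ * pr p Q q)
    (T : Finset κ) (w : ↥T → V) (q : R) :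
    pr p (fun ω => ((fun i : ↥T => W i.1 ω), Q ω)) (w, q) =
      ((Fintype.card V : ℝ) ^ T.card)⁻¹ * pr p Q q := by
  let glue : ({i // i ∉ T} → V) → κ → V :=
    fun v i => if h : i ∈ T then w ⟨i, h⟩ else v ⟨i, h⟩
  have hglue : ∀ v, pr p (fun ω => ((fun i : {i // i ∉ T} => W i.1 ω),
      ((fun i : ↥T => W i.1 ω), Q ω))) (v, (w, q)) =
      pr p (fun ω => ((fun i => W i ω), Q ω)) (glue v, q) := by
    intro v
    refine Finset.sum_congr (Finset.filter_congr fun ω _ => ?_) fun _ _ => rfl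
    simp only [Prod.mk.injEq, funext_iff, Subtype.forall, glue]
    constructor
    · rintro ⟨hv, hw, hq⟩
      refine ⟨fun i => ?_, hq⟩
      split_ifs with h
      exacts [hw i h, hv i h]
    · rintro ⟨h, hq⟩
      refine ⟨fun i hi => ?_, fun i hi => ?_, hq⟩ <;> simpa [hi] using h i
  rw [← sum_pr_prodMk (fun ω (i : {i // i ∉ T}) => W i.1 ω)]
  simp only [hglue, hU, Finset.sum_const, nsmul_eq_mul, Finset.card_univ, Fintype.card_pi,
    Finset.prod_const]
  have hc : Fintype.card κ = T.card + Fintype.card {i // i ∉ T} := by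
    rw [Fintype.card_subtype_compl, Fintype.card_coe]
    have := T.card_le_univ
    omega
  have hV : (Fintype.card V : ℝ) ≠ 0 := by simp
  rw [hc, pow_add]
  push_cast
  field_simp

lemma ent_restrict_of_uniform [Fintype R] (b : ℝ) (hp : ∀ ω, 0 ≤ p ω) (hp1 : ∑ ω, p ω = 1)
    {W : κ → Ω → V} {Q : Ω → R}
    (hU : ∀ w q, pr p (fun ω => ((fun i => W i ω), Q ω)) (w, q) =
      ((Fintype.card V : ℝ) ^ Fintype.card κ)⁻¹ * pr p Q q) (T : Finset κ) :
    ent b p (fun ω => ((fun i : ↥T => W i.1 ω), Q ω)) =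
      T.card * Real.logb b (Fintype.card V) + ent b p Q := by
  have hV : (Fintype.card V : ℝ) ≠ 0 := by simp
  have key : ∀ ω, p ω * Real.logb b (pr p (fun ω => ((fun i : ↥T => W i.1 ω), Q ω))
      ((fun i : ↥T => W i.1 ω), Q ω)) =
      p ω * Real.logb b (pr p Q (Q ω)) - p ω * (T.card * Real.logb b (Fintype.card V)) := by
    intro ω
    rcases (hp ω).eq_or_lt with h0 | h0
    · simp [← h0]
    have hQ := h0.trans_le (le_pr_apply hp Q ω)
    rw [pr_restrict_of_uniform hU, Real.logb_mul (inv_ne_zero (pow_ne_zero _ hV)) hQ.ne',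
      Real.logb_inv, Real.logb_pow]
    ring
  rw [ent_eq_sum, ent_eq_sum, Finset.sum_congr rfl fun ω _ => key ω, Finset.sum_sub_distrib,
    ← Finset.sum_mul, hp1]
  ring

end UniformFiles

/-- Lemma 1 of the paper (converse, regime `P ≥ (K-M)/2`):
`(K-M)·L ≤ ∑ₙ H(Aₙ^{S,𝒫} ∣ Q, W_S) + (K-M-P)·L - H(A₁ ∣ Q, W_S, W_𝒫)`. -/
theorem lemma1_converse
    (F : Type) [Field F] [Fintype F] [DecidableEq F]
    (QT AT : Type) [Fintype QT] [DecidableEq QT] [Fintype AT] [DecidableEq AT]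
    (Ω : Type) [Fintype Ω]
    (p : Ω → ℝ) (hp0 : ∀ ω, 0 ≤ p ω) (hp1 : ∑ ω, p ω = 1)
    (N K L M P : ℕ) (hN : 0 < N) (hMPK : M + P ≤ K)
    (W : Fin K → Ω → (Fin L → F))
    (Qu : ↥(demands K M P) → Fin N → Ω → QT)
    (A : ↥(demands K M P) → Fin N → Ω → AT)
    (Qall : Ω → (↥(demands K M P) → Fin N → QT))
    (hQall : Qall = fun ω d n => Qu d n ω)
    (S : Finset (Fin K)) (hS : S = Finset.univ.filter (fun i => i.val < M))
    (Pd : Finset (Fin K))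
    (hPdDef : Pd = Finset.univ.filter (fun i => M ≤ i.val ∧ i.val < M + P))
    (hPd : Pd ∈ demands K M P)
    -- the files are i.i.d. uniform on `F^L` and independent of all the queries
    (hUnif : ∀ (w : Fin K → Fin L → F) (q : ↥(demands K M P) → Fin N → QT),
      pr p (fun ω => ((fun i => W i ω), Qall ω)) (w, q)
        = ((Fintype.card F : ℝ) ^ (K * L))⁻¹ * pr p Qall q)
    -- each answer is a deterministic function of the library and the received query
    (hAns : ∀ (d : ↥(demands K M P)) (n : Fin N),
      detFn (A d n) (fun ω => ((fun i => W i ω), Qu d n ω)))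
    -- decodability
    (hDec : ∀ d : ↥(demands K M P),
      detFn (fun ω => (fun i : ↥(d : Finset (Fin K)) => W i.val ω))
        (fun ω => ((fun n => A d n ω), Qall ω, (fun i : ↥S => W i.val ω))))
    -- privacy/symmetry (i)
    (hSym : ∀ (n : Fin N) (d d' : ↥(demands K M P)) (T : Finset (Fin K)),
      condEnt (Fintype.card F) p (A d n)
          (fun ω => (Qall ω, (fun i : ↥T => W i.val ω)))
        = condEnt (Fintype.card F) p (A d' ⟨0, hN⟩)
          (fun ω => (Qall ω, (fun i : ↥T => W i.val ω))))
    -- privacy/symmetry (ii)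
    (hMix : ∀ (n : Fin N) (d d' : ↥(demands K M P)),
      detFn (fun ω => (fun i : ↥(d : Finset (Fin K)) => W i.val ω))
        (fun ω => ((fun m : Fin N => if m = n then A d' n ω else A d m ω),
          Qall ω, (fun i : ↥S => W i.val ω))))
    :
    ((K : ℝ) - M) * L
      ≤ (∑ n : Fin N, condEnt (Fintype.card F) p (A ⟨Pd, hPd⟩ n)
            (fun ω => (Qall ω, (fun i : ↥S => W i.val ω))))
        + ((K : ℝ) - M - P) * L
        - condEnt (Fintype.card F) p (A ⟨Pd, hPd⟩ ⟨0, hN⟩)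
            (fun ω => (Qall ω, (fun i : ↥S => W i.val ω), (fun i : ↥Pd => W i.val ω))) := by
  have hb : (1 : ℝ) < Fintype.card F := by exact_mod_cast Fintype.one_lt_card
  have hU : ∀ w q, pr p (fun ω => ((fun i => W i ω), Qall ω)) (w, q) =
      ((Fintype.card (Fin L → F) : ℝ) ^ Fintype.card (Fin K))⁻¹ * pr p Qall q := by
    intro w q
    rw [hUnif, Fintype.card_fun, Fintype.card_fin, Fintype.card_fin]
    push_cast
    rw [← pow_mul, mul_comm K L]
  have hlog : Real.logb (Fintype.card F) (Fintype.card (Fin L → F)) = L := by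
    rw [Fintype.card_fun, Fintype.card_fin]
    push_cast
    rw [Real.logb_pow, Real.logb_self_eq_one hb, mul_one]
  have hdisj : Disjoint S Pd := by
    rw [hS, hPdDef, Finset.disjoint_filter]
    intro i _ h1 h2
    omega
  have hcard : Pd.card = P := (Finset.mem_filter.mp hPd).2.1
  have hentS : ent (Fintype.card F) p (fun ω => (Qall ω, (fun i : ↥S => W i.val ω))) =
      S.card * L + ent (Fintype.card F) p Qall := by
    rw [← hlog, ← ent_restrict_of_uniform _ hp0 hp1 hU S]
    exact ent_eq_of_detFn hb hp0 ⟨Prod.swap, fun _ => rfl⟩ ⟨Prod.swap, fun _ => rfl⟩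
  have hentSP : ent (Fintype.card F) p
      (fun ω => (Qall ω, (fun i : ↥S => W i.val ω), (fun i : ↥Pd => W i.val ω))) =
      (S.card + P) * L + ent (Fintype.card F) p Qall := by
    have hun : (((S ∪ Pd).card : ℕ) : ℝ) = S.card + P := by
      rw [Finset.card_union_of_disjoint hdisj, hcard]
      push_cast
      rfl
    rw [← hun, ← hlog, ← ent_restrict_of_uniform _ hp0 hp1 hU (S ∪ Pd)]
    refine ent_eq_of_detFn hb hp0
      ⟨fun t => (t.2, fun i => t.1 ⟨i.1, Finset.mem_union_left _ i.2⟩,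
        fun i => t.1 ⟨i.1, Finset.mem_union_right _ i.2⟩), fun _ => rfl⟩
      ⟨fun t => (fun i => if h : i.1 ∈ S then t.2.1 ⟨i.1, h⟩
        else t.2.2 ⟨i.1, (Finset.mem_union.mp i.2).resolve_left h⟩, t.1), fun ω => ?_⟩
    refine Prod.ext (funext fun i => ?_) rfl
    by_cases h : i.1 ∈ S <;> simp [h]
  have hsub := condEnt_pi_fin_le_sum hb hp0 (fun ω => (Qall ω, (fun i : ↥S => W i.val ω))) N
    (A ⟨Pd, hPd⟩)
  have hdec := ent_le_of_decodable hb hp0 (fun t : Fin N → AT => t ⟨0, hN⟩) (hDec ⟨Pd, hPd⟩)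
  have hcond : condEnt (Fintype.card F) p (A ⟨Pd, hPd⟩ ⟨0, hN⟩)
      (fun ω => (Qall ω, (fun i : ↥S => W i.val ω), (fun i : ↥Pd => W i.val ω))) + P * L ≤
      condEnt (Fintype.card F) p (fun ω n => A ⟨Pd, hPd⟩ n ω)
        (fun ω => (Qall ω, (fun i : ↥S => W i.val ω))) := by
    rw [condEnt, condEnt, hentS, hentSP]
    linarith
  linarith
end

section
/- Main ratio identity for the achievable load in the regime P ≤ (K−M)/2 (the chain of equalities closing the achievability proof). Let N, P be positive integers with N ≥ 2, let K, M be natural numbers with M + P ≤ K, and let r = 1/(N^{1/P} − 1). Then the denominator ∑_{k=1}^{K} C(K,k)·r^{−k} − ∑_{k=1}^{K−P} C(K−P,k)·r^{−k} is strictly positive, and [∑_{k=1}^{K} C(K,k)·r^{−k} − ∑_{k=1}^{M} C(M,k)·r^{−k}] / [∑_{k=1}^{K} C(K,k)·r^{−k} − ∑_{k=1}^{K−P} C(K−P,k)·r^{−k}] = (N^{K/P} − N^{M/P})/(N^{K/P} − N^{(K−P)/P}) = (1 − (1/N)^{(K−M)/P})/(1 − 1/N). -/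
open scoped BigOperators

/-- The binomial theorem without its constant term, in inverse powers of `r`. -/
theorem sum_Icc_one_choose_mul_rpow_neg {r : ℝ} (hr : 0 ≤ r) (n : ℕ) :
    ∑ k ∈ Finset.Icc 1 n, (n.choose k : ℝ) * r ^ (-(k : ℝ)) = (r⁻¹ + 1) ^ n - 1 := by
  rw [add_pow, Finset.sum_range_succ', Finset.range_eq_Ico, Finset.sum_Ico_add'
    (fun k => r⁻¹ ^ k * 1 ^ (n - k) * (n.choose k : ℝ)), ← Finset.Ico_add_one_right_eq_Icc]
  simp [Real.rpow_neg hr, mul_comm]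

/-- The truncated binomial sum at `r = 1 / (N ^ (1 / P) - 1)`. -/
theorem sum_Icc_one_choose_mul_rpow_neg_eq {N P : ℕ} (hN : 2 ≤ N) (hP : 1 ≤ P) (n : ℕ) :
    ∑ k ∈ Finset.Icc 1 n,
        (n.choose k : ℝ) * (1 / ((N : ℝ) ^ ((1 : ℝ) / P) - 1)) ^ (-(k : ℝ))
      = (N : ℝ) ^ ((n : ℝ) / P) - 1 := by
  have hN' : (1 : ℝ) < N := by exact_mod_cast hN
  have hP' : (0 : ℝ) < P := by exact_mod_cast hP
  have hx : 1 < (N : ℝ) ^ ((1 : ℝ) / P) := Real.one_lt_rpow hN' (by positivity)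
  rw [sum_Icc_one_choose_mul_rpow_neg (one_div_nonneg.2 (sub_nonneg.2 hx.le)), one_div, inv_inv,
    sub_add_cancel, ← Real.rpow_mul_natCast (by positivity)]
  congr 2
  ring

/-- Main ratio identity for the achievable load in the regime `P ≤ (K-M)/2`:
with `N ≥ 2`, `P ≥ 1`, `M + P ≤ K` and `r = 1/(N^{1/P} - 1)`, the denominator
`∑_{k=1}^{K} C(K,k)·r^{-k} - ∑_{k=1}^{K-P} C(K-P,k)·r^{-k}` is strictly
positive, and
`[∑_{k=1}^{K} C(K,k)·r^{-k} - ∑_{k=1}^{M} C(M,k)·r^{-k}] /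
 [∑_{k=1}^{K} C(K,k)·r^{-k} - ∑_{k=1}^{K-P} C(K-P,k)·r^{-k}]
  = (N^{K/P} - N^{M/P})/(N^{K/P} - N^{(K-P)/P})
  = (1 - (1/N)^{(K-M)/P})/(1 - 1/N)`. -/
theorem main_ratio_identity (N P K M : ℕ) (hN : 2 ≤ N) (hP : 1 ≤ P)
    (hMPK : M + P ≤ K)
    (r : ℝ) (hr : r = 1 / ((N : ℝ) ^ ((1 : ℝ) / P) - 1)) :
    0 < (∑ k ∈ Finset.Icc 1 K, (K.choose k : ℝ) * r ^ (-(k : ℝ)))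
        - ∑ k ∈ Finset.Icc 1 (K - P), ((K - P).choose k : ℝ) * r ^ (-(k : ℝ))
    ∧ ((∑ k ∈ Finset.Icc 1 K, (K.choose k : ℝ) * r ^ (-(k : ℝ)))
          - ∑ k ∈ Finset.Icc 1 M, (M.choose k : ℝ) * r ^ (-(k : ℝ))) /
        ((∑ k ∈ Finset.Icc 1 K, (K.choose k : ℝ) * r ^ (-(k : ℝ)))
          - ∑ k ∈ Finset.Icc 1 (K - P), ((K - P).choose k : ℝ) * r ^ (-(k : ℝ)))
      = ((N : ℝ) ^ ((K : ℝ) / P) - (N : ℝ) ^ ((M : ℝ) / P)) /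
          ((N : ℝ) ^ ((K : ℝ) / P) - (N : ℝ) ^ (((K : ℝ) - P) / P))
    ∧ ((N : ℝ) ^ ((K : ℝ) / P) - (N : ℝ) ^ ((M : ℝ) / P)) /
          ((N : ℝ) ^ ((K : ℝ) / P) - (N : ℝ) ^ (((K : ℝ) - P) / P))
      = (1 - (1 / (N : ℝ)) ^ (((K : ℝ) - M) / P)) / (1 - 1 / (N : ℝ)) := by
  subst hr
  have hN' : (1 : ℝ) < N := by exact_mod_cast hN
  have hN0 : (0 : ℝ) < N := by positivity
  have hP' : (0 : ℝ) < P := by exact_mod_cast hP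
  have hPK : P ≤ K := by omega
  simp only [sum_Icc_one_choose_mul_rpow_neg_eq hN hP, Nat.cast_sub hPK, sub_sub_sub_cancel_right]
  refine ⟨?_, trivial, ?_⟩
  · rw [sub_pos]
    exact Real.rpow_lt_rpow_of_exponent_lt hN' (by gcongr; linarith)
  · have hKP : (N : ℝ) ^ (((K : ℝ) - P) / P) = (N : ℝ) ^ ((K : ℝ) / P) * (1 / N) := by
      rw [sub_div, div_self hP'.ne', Real.rpow_sub hN0, Real.rpow_one, mul_one_div]
    have hKM : (N : ℝ) ^ ((M : ℝ) / P)
        = (N : ℝ) ^ ((K : ℝ) / P) * (1 / (N : ℝ)) ^ (((K : ℝ) - M) / P) := by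
      rw [one_div, Real.inv_rpow hN0.le, ← Real.rpow_neg hN0.le, ← Real.rpow_add hN0]
      congr 1
      ring
    rw [hKP, hKM, ← mul_one_sub, ← mul_one_sub, mul_div_mul_left _ _ (by positivity)]
end
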